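/- arXiv:1905.05597 — 4 statements merged into one kernel-verified Lean document; each statement's English description precedes it below -/
import Mathlib

section
/- Let N be a positive integer, let ρ ∈ (0,1], and let S be a binomial random variable with parameters N and ρ, and set ν := S/N. Then for every t ∈ [0,2], the probability that (ν/ρ)·ln(ν/ρ) > t is at most exp(−(1/12)·N·ρ·t²), where the convention 0·ln 0 = 0 is used when ν = 0. -/
theorem one_add_half_lt_of_lt_mul_log {x t : ℝ} (hx : 0 ≤ x) (ht0 : 0 ≤ t) (ht2 : t ≤ 2)
    (h : t < x * Real.log x) : 1 + t / 2 < x := by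
  by_contra! hle
  rcases le_or_gt x 1 with h1 | h1
  · have := Real.mul_log_nonpos hx h1
    linarith
  · have hlog : Real.log x ≤ x - 1 := Real.log_le_sub_one_of_pos (by linarith)
    nlinarith [mul_le_mul_of_nonneg_left hlog hx]

theorem sub_mul_log_one_add_le {u : ℝ} (hu0 : 0 ≤ u) (hu1 : u ≤ 1) :
    u - (1 + u) * Real.log (1 + u) ≤ -(u ^ 2 / 3) := by
  have hlog := Real.le_log_one_add_of_nonneg hu0
  have hmul := mul_le_mul_of_nonneg_left hlog (by linarith : (0 : ℝ) ≤ 1 + u)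
  have hrat : u + u ^ 2 / 3 ≤ (1 + u) * (2 * u / (u + 2)) := by
    rw [mul_div_assoc', le_div_iff₀ (by linarith)]
    nlinarith [mul_nonneg (mul_nonneg hu0 hu0) (sub_nonneg.2 hu1)]
  linarith

/-- Chernoff bound for a binomial law and an event contained in `{k | (1 + u) ρ N < k}`. -/
theorem binomial_chernoff (N : ℕ) {ρ u : ℝ} (hρ0 : 0 ≤ ρ) (hρ1 : ρ ≤ 1) (hu : 0 ≤ u)
    (p : ℕ → Prop) [DecidablePred p] (hp : ∀ k, p k → (1 + u) * ρ * N < k) :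
    (∑ k ∈ Finset.range (N + 1),
        if p k then (N.choose k : ℝ) * ρ ^ k * (1 - ρ) ^ (N - k) else 0)
      ≤ Real.exp (N * ρ * (u - (1 + u) * Real.log (1 + u))) := by
  have hu' : 0 < 1 + u := by linarith
  have hlog : 0 ≤ Real.log (1 + u) := Real.log_nonneg (by linarith)
  set c := Real.exp (-(Real.log (1 + u) * ((1 + u) * ρ * N))) with hc
  have hterm : ∀ k ∈ Finset.range (N + 1),
      (if p k then (N.choose k : ℝ) * ρ ^ k * (1 - ρ) ^ (N - k) else 0)
        ≤ c * ((ρ * (1 + u)) ^ k * (1 - ρ) ^ (N - k) * N.choose k) := by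
    intro k _
    have hρ' : 0 ≤ 1 - ρ := by linarith
    split_ifs with hk
    · have hone : 1 ≤ c * (1 + u) ^ k := by
        rw [← Real.exp_log (pow_pos hu' k), Real.log_pow, hc, ← Real.exp_add, Real.one_le_exp_iff]
        nlinarith [mul_le_mul_of_nonneg_left (hp k hk).le hlog]
      calc (N.choose k : ℝ) * ρ ^ k * (1 - ρ) ^ (N - k)
          ≤ (c * (1 + u) ^ k) * ((N.choose k : ℝ) * ρ ^ k * (1 - ρ) ^ (N - k)) :=
            le_mul_of_one_le_left (by positivity) hone
        _ = _ := by rw [mul_pow]; ring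
    · positivity
  calc _ ≤ ∑ k ∈ Finset.range (N + 1),
        c * ((ρ * (1 + u)) ^ k * (1 - ρ) ^ (N - k) * N.choose k) := Finset.sum_le_sum hterm
    _ = c * (ρ * u + 1) ^ N := by
        rw [← Finset.mul_sum, ← add_pow]
        ring
    _ ≤ c * Real.exp (ρ * u) ^ N := by
        gcongr
        exact Real.add_one_le_exp _
    _ = _ := by
        rw [← Real.exp_nat_mul, hc, ← Real.exp_add]
        ring_nf

/-- Tail bound for a scaled binomial random variable `ν = S/N`, `S ∼ Bin(N, ρ)`:
for `t ∈ [0,2]`, `ℙ((ν/ρ)·ln(ν/ρ) > t) ≤ exp(−(1/12)·N·ρ·t²)`.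
Note that `Real.log 0 = 0`, so the convention `0·ln 0 = 0` is automatic when `ν = 0`. -/
theorem binomial_log_tail (N : ℕ) (hN : 0 < N) (ρ : ℝ) (hρ0 : 0 < ρ) (hρ1 : ρ ≤ 1)
    (t : ℝ) (ht0 : 0 ≤ t) (ht2 : t ≤ 2) :
    (∑ k ∈ Finset.range (N + 1),
        if (((k : ℝ) / N) / ρ) * Real.log (((k : ℝ) / N) / ρ) > t then
          (N.choose k : ℝ) * ρ ^ k * (1 - ρ) ^ (N - k) else 0)
      ≤ Real.exp (-(1 / 12) * N * ρ * t ^ 2) := by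
  have hN' : (0 : ℝ) < N := by exact_mod_cast hN
  have hevent : ∀ k : ℕ, (((k : ℝ) / N) / ρ) * Real.log (((k : ℝ) / N) / ρ) > t →
      (1 + t / 2) * ρ * N < k := by
    intro k hk
    have h := one_add_half_lt_of_lt_mul_log (by positivity) ht0 ht2 hk
    rwa [lt_div_iff₀ hρ0, lt_div_iff₀ hN'] at h
  refine (binomial_chernoff N hρ0.le hρ1 (by linarith : 0 ≤ t / 2) _ hevent).trans ?_
  rw [Real.exp_le_exp]
  have h := mul_le_mul_of_nonneg_left
    (sub_mul_log_one_add_le (by linarith : 0 ≤ t / 2) (by linarith)) (mul_pos hN' hρ0).le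
  linarith
end

section
/- Let X and U be nonempty finite sets, let ρ ∈ (0,1] be such that ρ·|X| and ρ·|U| are integers, and let R ⊆ X × U be a relation such that for every u ∈ U the fiber {x ∈ X : (x,u) ∈ R} has cardinality ρ·|X| and for every x ∈ X the fiber {u ∈ U : (x,u) ∈ R} has cardinality ρ·|U|. Let N be a positive integer, and for ū ∈ U^N and x ∈ X set ν(x,ū) := #{n ∈ {1,…,N} : (x,u_n) ∈ R}/N. Then for every t ∈ [0,2], the probability (with respect to the uniform measure on U^N) of the event {ū ∈ U^N : Σ_{x∈X} (ν(x,ū)/(ρ·|X|))·ln(N·ν(x,ū)) > ln(N·ρ) + t} is at most |X|·exp(−(1/12)·N·ρ·t²), where terms with ν(x,ū) = 0 are interpreted as 0. -/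
open Finset

attribute [local instance] Classical.propDecidable

/-- A lower bound for the Poisson rate function `t e^t - e^t + 1` at small arguments. -/
lemma exp_sub_one_sub_mul_exp_le {t : ℝ} (ht0 : 0 ≤ t) (ht2 : t ≤ 2) :
    Real.exp t - 1 - t * Real.exp t ≤ -(1 / 12) * t ^ 2 := by
  have h1 : 1 - t / 2 ≤ Real.exp (-(t / 2)) := by
    linarith [Real.add_one_le_exp (-(t / 2))]
  have h2 : (1 - t / 2) ^ 2 ≤ Real.exp (-t) := by
    calc (1 - t / 2) ^ 2 ≤ Real.exp (-(t / 2)) ^ 2 := by gcongr; linarith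
      _ = Real.exp (-t) := by rw [← Real.exp_nat_mul]; congr 1; push_cast; ring
  have h3 : 1 - t ≤ Real.exp (-t) * (1 - t ^ 2 / 12) := by
    have h4 : (1 - t / 2) ^ 2 * (1 - t ^ 2 / 12) ≤ Real.exp (-t) * (1 - t ^ 2 / 12) := by
      gcongr
      nlinarith
    nlinarith [mul_nonneg (sq_nonneg t) (mul_nonneg ht0 (sub_nonneg.2 ht2))]
  have h5 := mul_le_mul_of_nonneg_left h3 (Real.exp_pos t).le
  rw [← mul_assoc, ← Real.exp_add, add_neg_cancel, Real.exp_zero] at h5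
  linarith

/-- The moment generating function of a binomial count over a uniform sample, as a sum. -/
lemma sum_exp_mul_card_filter {U : Type*} [Fintype U] (A : U → Prop) {ρ : ℝ}
    (hA : ((univ.filter A).card : ℝ) = ρ * Fintype.card U) (N : ℕ) (t : ℝ) :
    ∑ ubar : Fin N → U, Real.exp (t * ((univ.filter fun n => A (ubar n)).card : ℝ))
      = (Fintype.card U * (1 + ρ * (Real.exp t - 1))) ^ N := by
  have h1 : ∑ u : U, (if A u then Real.exp t else 1)
      = Fintype.card U * (1 + ρ * (Real.exp t - 1)) := by
    have h2 : ∀ u : U, (if A u then Real.exp t else 1)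
        = 1 + (Real.exp t - 1) * (if A u then 1 else 0) := by
      intro u; split_ifs <;> ring
    simp_rw [h2, sum_add_distrib, ← mul_sum, sum_boole, hA]
    simp
    ring
  rw [← h1, Fintype.sum_pow]
  refine sum_congr rfl fun ubar _ => ?_
  rw [prod_ite, prod_const, prod_const_one, mul_one, mul_comm, Real.exp_nat_mul]

/-- Multiplicative Chernoff bound for the number of sample points in a set of density `ρ`. -/
lemma card_filter_lt_le_exp {U : Type*} [Fintype U] [Nonempty U] (A : U → Prop) {ρ : ℝ}
    (hρ : 0 ≤ ρ) (hA : ((univ.filter A).card : ℝ) = ρ * Fintype.card U) (N : ℕ) {t : ℝ}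
    (ht : 0 ≤ t) :
    ((univ.filter fun ubar : Fin N → U =>
        N * ρ * Real.exp t < ((univ.filter fun n => A (ubar n)).card : ℝ)).card : ℝ)
      ≤ (Fintype.card U : ℝ) ^ N
        * Real.exp (N * ρ * (Real.exp t - 1 - t * Real.exp t)) := by
  set S := univ.filter fun ubar : Fin N → U =>
    N * ρ * Real.exp t < ((univ.filter fun n => A (ubar n)).card : ℝ)
  have h1 : (S.card : ℝ) * Real.exp (t * (N * ρ * Real.exp t))
      ≤ (Fintype.card U * (1 + ρ * (Real.exp t - 1))) ^ N := by
    rw [← sum_exp_mul_card_filter A hA N t, ← nsmul_eq_mul, ← sum_const]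
    calc ∑ _ubar ∈ S, Real.exp (t * (N * ρ * Real.exp t))
        ≤ ∑ ubar ∈ S, Real.exp (t * ((univ.filter fun n => A (ubar n)).card : ℝ)) := by
          refine sum_le_sum fun ubar hu => ?_
          have := (mem_filter.1 hu).2
          gcongr
      _ ≤ _ := sum_le_sum_of_subset_of_nonneg (subset_univ _) fun _ _ _ => (Real.exp_pos _).le
  have h0 : 0 ≤ ρ * (Real.exp t - 1) :=
    mul_nonneg hρ (sub_nonneg.2 (Real.one_le_exp ht))
  have h2 : (1 + ρ * (Real.exp t - 1)) ^ N ≤ Real.exp (N * (ρ * (Real.exp t - 1))) := by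
    rw [Real.exp_nat_mul]
    gcongr
    linarith [Real.add_one_le_exp (ρ * (Real.exp t - 1))]
  have h3 : (S.card : ℝ) * Real.exp (t * (N * ρ * Real.exp t))
      ≤ (Fintype.card U : ℝ) ^ N * Real.exp (N * (ρ * (Real.exp t - 1))) := by
    rw [mul_pow] at h1
    exact h1.trans (by gcongr)
  rw [show N * ρ * (Real.exp t - 1 - t * Real.exp t)
      = N * (ρ * (Real.exp t - 1)) - t * (N * ρ * Real.exp t) by ring, Real.exp_sub,
    ← mul_div_assoc, le_div_iff₀ (Real.exp_pos _)]
  exact h3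

/-- The fiber counts of a relation whose `u`-fibers all have size `c` sum to `N * c`. -/
lemma sum_card_filter_fiber {X U : Type*} [Fintype X] (R : X → U → Prop) {c : ℝ}
    (hR : ∀ u : U, ((univ.filter fun x : X => R x u).card : ℝ) = c) {N : ℕ}
    (ubar : Fin N → U) :
    ∑ x : X, ((univ.filter fun n : Fin N => R x (ubar n)).card : ℝ) = N * c := by
  simp_rw [← sum_boole]
  rw [sum_comm]
  simp_rw [sum_boole, hR]
  simp

/-- If a weighted mean of `log a` exceeds `log b`, with weights proportional to `a`, then some
`a x` exceeds `b`. -/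
lemma exists_lt_of_log_lt_sum_mul_log {X : Type*} [Fintype X] {a : X → ℝ} {b s : ℝ}
    (ha : ∀ x, 0 ≤ a x) (hs : 0 < s) (hsum : ∑ x, a x = s)
    (h : Real.log b < ∑ x, a x / s * Real.log (a x)) : ∃ x, b < a x := by
  by_contra! hle
  refine h.not_ge ?_
  calc ∑ x, a x / s * Real.log (a x) ≤ ∑ x, a x / s * Real.log b := by
        refine sum_le_sum fun x _ => ?_
        rcases (ha x).eq_or_lt with h0 | h0
        · simp [← h0]
        · have := Real.log_le_log h0 (hle x)
          gcongr
    _ = Real.log b := by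
        rw [← sum_mul, ← sum_div, hsum, div_self hs.ne', one_mul]

/-- Let `R ⊆ X × U` be a bi-regular relation between nonempty finite sets: every
`u`-fiber has cardinality `ρ·|X|` and every `x`-fiber has cardinality `ρ·|U|`.
For `ubar ∈ U^N` and `x ∈ X` let `ν(x,ubar) = #{n : (x, uₙ) ∈ R} / N`.  Then for every
`t ∈ [0,2]`, the probability (uniform measure on `U^N`) that
`Σ_{x∈X} (ν(x,ubar)/(ρ·|X|))·ln(N·ν(x,ubar)) > ln(N·ρ) + t` is at most
`|X|·exp(−(1/12)·N·ρ·t²)`.  (When `ν(x,ubar) = 0` the corresponding term vanishes,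
matching the convention `0·ln 0 = 0`.) -/
theorem height_probability_bound {X U : Type*} [Fintype X] [Fintype U]
    [Nonempty X] [Nonempty U]
    (ρ : ℝ) (hρ0 : 0 < ρ) (hρ1 : ρ ≤ 1) (R : X → U → Prop)
    (hXfib : ∀ u : U, ((univ.filter fun x : X => R x u).card : ℝ) = ρ * Fintype.card X)
    (hUfib : ∀ x : X, ((univ.filter fun u : U => R x u).card : ℝ) = ρ * Fintype.card U)
    (N : ℕ) (hN : 0 < N) (t : ℝ) (ht0 : 0 ≤ t) (ht2 : t ≤ 2) :
    ((univ.filter fun ubar : Fin N → U =>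
        (∑ x : X,
            (((univ.filter fun n : Fin N => R x (ubar n)).card : ℝ) / N / (ρ * Fintype.card X))
              * Real.log (N * (((univ.filter fun n : Fin N => R x (ubar n)).card : ℝ) / N)))
          > Real.log (N * ρ) + t).card : ℝ)
        / (Fintype.card U : ℝ) ^ N
      ≤ Fintype.card X * Real.exp (-(1 / 12) * N * ρ * t ^ 2) := by
  have hU : (0 : ℝ) < Fintype.card U := by exact_mod_cast Fintype.card_pos
  have hX : (0 : ℝ) < Fintype.card X := by exact_mod_cast Fintype.card_pos
  have hN' : (0 : ℝ) < N := by exact_mod_cast hN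
  rw [div_le_iff₀ (pow_pos hU N)]
  have hsub : (univ.filter fun ubar : Fin N → U =>
        (∑ x : X,
            (((univ.filter fun n : Fin N => R x (ubar n)).card : ℝ) / N / (ρ * Fintype.card X))
              * Real.log (N * (((univ.filter fun n : Fin N => R x (ubar n)).card : ℝ) / N)))
          > Real.log (N * ρ) + t)
      ⊆ univ.biUnion fun x : X => univ.filter fun ubar : Fin N → U =>
        N * ρ * Real.exp t < ((univ.filter fun n => R x (ubar n)).card : ℝ) := by
    intro ubar h
    simp only [mem_filter, mem_univ, true_and, mem_biUnion] at h ⊢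
    refine exists_lt_of_log_lt_sum_mul_log (fun _ => Nat.cast_nonneg _)
      (mul_pos hN' (mul_pos hρ0 hX)) (sum_card_filter_fiber R hXfib ubar) ?_
    rw [Real.log_mul (by positivity) (by positivity), Real.log_exp]
    simpa only [mul_div_cancel₀ _ hN'.ne', div_div, gt_iff_lt] using h
  have hexp : Real.exp (N * ρ * (Real.exp t - 1 - t * Real.exp t))
      ≤ Real.exp (-(1 / 12) * N * ρ * t ^ 2) := by
    rw [show -(1 / 12) * N * ρ * t ^ 2 = N * ρ * (-(1 / 12) * t ^ 2) by ring]
    have := exp_sub_one_sub_mul_exp_le ht0 ht2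
    gcongr
  calc _ ≤ ∑ x : X, ((univ.filter fun ubar : Fin N → U =>
          N * ρ * Real.exp t < ((univ.filter fun n => R x (ubar n)).card : ℝ)).card : ℝ) := by
        exact_mod_cast (card_le_card hsub).trans card_biUnion_le
    _ ≤ ∑ _x : X, (Fintype.card U : ℝ) ^ N * Real.exp (-(1 / 12) * N * ρ * t ^ 2) :=
        sum_le_sum fun x _ => (card_filter_lt_le_exp (R x) hρ0.le (hUfib x) N ht0).trans
          (by gcongr)
    _ = _ := by
        rw [sum_const, card_univ, nsmul_eq_mul]
        ring
end

section
/- Let X and U be nonempty finite sets, let ρ ∈ (0,1] be such that ρ·|X| and ρ·|U| are integers, and let R ⊆ X × U be a relation such that for every u ∈ U the fiber {x ∈ X : (x,u) ∈ R} has cardinality ρ·|X| and for every x ∈ X the fiber {u ∈ U : (x,u) ∈ R} has cardinality ρ·|U|. Assume |X| ≥ e^{20}. Then for every positive integer N with N·ρ ≥ (ln|X|)³ there exists a sample ū = (u₁,…,u_N) ∈ U^N such that, with ν(x,ū) := #{n ∈ {1,…,N} : (x,u_n) ∈ R}/N, both of the following hold: (1) Σ_{x∈X} |ν(x,ū) −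 ρ| ≤ 10·ρ·|X|/ln|X|, and (2) Σ_{x∈X} (ν(x,ū)/(ρ·|X|))·ln(N·ν(x,ū)) ≤ ln(N·ρ) + 2, where terms with ν(x,ū) = 0 are interpreted as 0. -/
open Finset

attribute [local instance] Classical.propDecidable

/-- If every `g x` has sum zero and every column `g · u` has squared norm at most `B`, then for each
`N` some sequence of `N` columns has a sum with squared norm at most `N * B`. -/
theorem exists_sum_sq_le {X U : Type*} [Fintype X] [Fintype U] [Nonempty U]
    (g : X → U → ℝ) (B : ℝ) (hsum : ∀ x, ∑ u, g x u = 0) (hB : ∀ u, ∑ x, g x u ^ 2 ≤ B) (N : ℕ) :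
    ∃ w : Fin N → U, ∑ x, (∑ n, g x (w n)) ^ 2 ≤ N * B := by
  induction N with
  | zero => exact ⟨Fin.elim0, by simp⟩
  | succ N ih =>
    obtain ⟨w, hw⟩ := ih
    obtain ⟨a, ha⟩ : ∃ a, ∑ x, (∑ n, g x (w n)) * g x a ≤ 0 := by
      have h : ∑ a, ∑ x, (∑ n, g x (w n)) * g x a ≤ ∑ _a : U, (0 : ℝ) := by
        rw [sum_comm]
        simp [← mul_sum, hsum]
      obtain ⟨a, -, ha⟩ := exists_le_of_sum_le univ_nonempty h
      exact ⟨a, ha⟩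
    refine ⟨Fin.cons a w, ?_⟩
    have h : ∑ x, (∑ n, g x ((Fin.cons a w : Fin (N + 1) → U) n)) ^ 2
        = ∑ x, g x a ^ 2 + 2 * ∑ x, (∑ n, g x (w n)) * g x a
          + ∑ x, (∑ n, g x (w n)) ^ 2 := by
      rw [mul_sum, ← sum_add_distrib, ← sum_add_distrib]
      refine sum_congr rfl fun x _ => ?_
      rw [Fin.sum_univ_succ]
      simp only [Fin.cons_zero, Fin.cons_succ]
      ring
    rw [h]
    push_cast
    linarith [hB a]

/-- A bi-regular relation of density `ρ` has, for each `N`, a sample of `N` columns whose counting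
function deviates from its mean `N * ρ` by at most the variance `N * ρ` on average. -/
theorem exists_sum_card_sub_sq_le {X U : Type*} [Fintype X] [Fintype U] [Nonempty U]
    (ρ : ℝ) (R : X → U → Prop)
    (hXfib : ∀ u : U, ((univ.filter fun x : X => R x u).card : ℝ) = ρ * Fintype.card X)
    (hUfib : ∀ x : X, ((univ.filter fun u : U => R x u).card : ℝ) = ρ * Fintype.card U) (N : ℕ) :
    ∃ w : Fin N → U,
      ∑ x : X, (((univ.filter fun n : Fin N => R x (w n)).card : ℝ) - N * ρ) ^ 2
        ≤ Fintype.card X * (N * ρ) := by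
  obtain ⟨w, hw⟩ := exists_sum_sq_le (fun x u => (if R x u then (1 : ℝ) else 0) - ρ)
    (ρ * Fintype.card X)
    (fun x => by
      rw [sum_sub_distrib, sum_boole, hUfib]
      simp [mul_comm])
    (fun u => by
      have h : ∀ x, ((if R x u then (1 : ℝ) else 0) - ρ) ^ 2
          = (1 - 2 * ρ) * (if R x u then (1 : ℝ) else 0) + ρ ^ 2 := fun x => by
        split_ifs <;> ring
      simp only [h]
      rw [sum_add_distrib, ← mul_sum, sum_boole, hXfib]
      simp only [sum_const, card_univ, nsmul_eq_mul]
      have : (0 : ℝ) ≤ ρ ^ 2 * Fintype.card X := by positivity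
      linarith) N
  refine ⟨w, le_of_eq_of_le (sum_congr rfl fun x _ => ?_) (hw.trans_eq (by ring))⟩
  rw [sum_sub_distrib, sum_boole]
  simp

/-- Double counting: the total number of incidences of a sample with a relation all of whose columns
have cardinality `ρ * |X|`. -/
theorem sum_card_sample_eq {X U : Type*} [Fintype X] (ρ : ℝ) (R : X → U → Prop)
    (hXfib : ∀ u : U, ((univ.filter fun x : X => R x u).card : ℝ) = ρ * Fintype.card X)
    {N : ℕ} (w : Fin N → U) :
    ∑ x : X, ((univ.filter fun n : Fin N => R x (w n)).card : ℝ)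
      = Fintype.card X * (N * ρ) := by
  simp only [← sum_boole]
  rw [sum_comm]
  simp only [sum_boole, hXfib, sum_const, card_univ, Fintype.card_fin, nsmul_eq_mul]
  ring

/-- A function with mean square deviation at most `m` from `m` has mean absolute deviation at most
`√m`. -/
theorem sum_abs_sub_le {X : Type*} [Fintype X] (c : X → ℝ) (m : ℝ)
    (hV : ∑ x, (c x - m) ^ 2 ≤ Fintype.card X * m) :
    ∑ x, |c x - m| ≤ Fintype.card X * √m := by
  have h := sq_sum_le_card_mul_sum_sq (s := (univ : Finset X)) (f := fun x => |c x - m|)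
  simp only [sq_abs, card_univ] at h
  rw [← Real.sqrt_sq (Nat.cast_nonneg (α := ℝ) (Fintype.card X)), ← Real.sqrt_mul (sq_nonneg _)]
  refine Real.le_sqrt_of_sq_le (h.trans ?_)
  calc _ ≤ (Fintype.card X : ℝ) * (Fintype.card X * m) := by gcongr
    _ = _ := by ring

/-- An entropy bound for a nonnegative function of mean `m` and variance at most `m`. -/
theorem sum_mul_log_le {X : Type*} [Fintype X] (c : X → ℝ) (m : ℝ) (hm : 0 < m)
    (hc : ∀ x, 0 ≤ c x) (hsum : ∑ x, c x = Fintype.card X * m)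
    (hV : ∑ x, (c x - m) ^ 2 ≤ Fintype.card X * m) :
    ∑ x, c x * Real.log (c x) ≤ Fintype.card X * (m * Real.log m + 1) := by
  have hpt : ∀ x, c x * Real.log (c x)
      ≤ c x * Real.log m + ((c x - m) ^ 2 + m * (c x - m)) / m := fun x => by
    rcases (hc x).eq_or_lt with h | h
    · simp [← h]
      field_simp
      simp
    · have h1 := Real.log_le_sub_one_of_pos (div_pos h hm)
      rw [Real.log_div h.ne' hm.ne'] at h1
      have h2 := mul_le_mul_of_nonneg_left h1 h.le
      have h3 : ((c x - m) ^ 2 + m * (c x - m)) / m = c x * (c x / m - 1) := by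
        field_simp
        ring
      rw [h3]
      linarith
  refine (sum_le_sum fun x _ => hpt x).trans ?_
  rw [sum_add_distrib, ← sum_mul, ← sum_div, sum_add_distrib, ← mul_sum, sum_sub_distrib, hsum]
  simp only [sum_const, card_univ, nsmul_eq_mul, sub_self, mul_zero, add_zero]
  have : (∑ x, (c x - m) ^ 2) / m ≤ Fintype.card X := (div_le_iff₀ hm).2 hV
  linarith

/-- Let `R ⊆ X × U` be a bi-regular relation between nonempty finite sets: every
`u`-fiber has cardinality `ρ·|X|` and every `x`-fiber has cardinality `ρ·|U|`.
Assume `|X| ≥ e^20`.  Then for every `N ≥ 1` with `N·ρ ≥ (ln |X|)³` there is a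
sample `ubar ∈ U^N` such that, with `ν(x,ubar) = #{n : (x, uₙ) ∈ R} / N`, one has
`Σ_{x∈X} |ν(x,ubar) − ρ| ≤ 10·ρ·|X| / ln |X|` and
`Σ_{x∈X} (ν(x,ubar)/(ρ·|X|))·ln(N·ν(x,ubar)) ≤ ln(N·ρ) + 2`. -/
theorem exists_good_sample {X U : Type*} [Fintype X] [Fintype U]
    [Nonempty X] [Nonempty U]
    (ρ : ℝ) (hρ0 : 0 < ρ) (hρ1 : ρ ≤ 1) (R : X → U → Prop)
    (hXfib : ∀ u : U, ((univ.filter fun x : X => R x u).card : ℝ) = ρ * Fintype.card X)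
    (hUfib : ∀ x : X, ((univ.filter fun u : U => R x u).card : ℝ) = ρ * Fintype.card U)
    (hXbig : Real.exp 20 ≤ (Fintype.card X : ℝ))
    (N : ℕ) (hN : 0 < N) (hNρ : (Real.log (Fintype.card X)) ^ 3 ≤ N * ρ) :
    ∃ ubar : Fin N → U,
      (∑ x : X, |((univ.filter fun n : Fin N => R x (ubar n)).card : ℝ) / N - ρ|)
          ≤ 10 * ρ * Fintype.card X / Real.log (Fintype.card X)
      ∧ (∑ x : X,
            (((univ.filter fun n : Fin N => R x (ubar n)).card : ℝ) / N / (ρ * Fintype.card X))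
              * Real.log (N * (((univ.filter fun n : Fin N => R x (ubar n)).card : ℝ) / N)))
          ≤ Real.log (N * ρ) + 2 := by
  obtain ⟨w, hV⟩ := exists_sum_card_sub_sq_le ρ R hXfib hUfib N
  have hsum := sum_card_sample_eq ρ R hXfib w
  set c : X → ℝ := fun x => ((univ.filter fun n : Fin N => R x (w n)).card : ℝ) with hc
  have hN0 : (0 : ℝ) < N := Nat.cast_pos.2 hN
  have hk : (0 : ℝ) < Fintype.card X := (Real.exp_pos 20).trans_le hXbig
  have hL : 20 ≤ Real.log (Fintype.card X) := (Real.le_log_iff_exp_le hk).2 hXbig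
  have hm : 0 < N * ρ := by positivity
  have hm1 : 1 ≤ N * ρ := (one_le_pow₀ (by linarith)).trans hNρ
  refine ⟨w, ?_, ?_⟩
  · have habs := sum_abs_sub_le c (N * ρ) hV
    have hterm : ∀ x, |c x / N - ρ| = |c x - N * ρ| / N := fun x => by
      rw [← abs_of_pos hN0, ← abs_div, abs_of_pos hN0]
      congr 1
      field_simp
    have hLsqrt : Real.log (Fintype.card X) ≤ √(N * ρ) := by
      refine Real.le_sqrt_of_sq_le (le_trans ?_ hNρ)
      exact pow_le_pow_right₀ (by linarith) (by norm_num)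
    change ∑ x, |c x / N - ρ| ≤ _
    simp only [hterm]
    rw [← sum_div, div_le_div_iff₀ hN0 (by linarith)]
    have hsq : √(N * ρ) * √(N * ρ) = N * ρ := Real.mul_self_sqrt hm.le
    calc (∑ x, |c x - N * ρ|) * Real.log (Fintype.card X)
        ≤ (Fintype.card X * √(N * ρ)) * √(N * ρ) := by gcongr
      _ = Fintype.card X * (N * ρ) := by rw [mul_assoc, hsq]
      _ ≤ 10 * (Fintype.card X * (N * ρ)) := by
        have : 0 < Fintype.card X * (N * ρ) := by positivity
        linarith
      _ = _ := by ring
  · have hent := sum_mul_log_le c (N * ρ) hm (fun x => Nat.cast_nonneg _) hsum hV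
    have hterm : ∀ x, c x / N / (ρ * Fintype.card X) * Real.log (N * (c x / N))
        = c x * Real.log (c x) / (Fintype.card X * (N * ρ)) := fun x => by
      rw [mul_div_cancel₀ _ hN0.ne']
      field_simp
    change ∑ x, c x / N / (ρ * Fintype.card X) * Real.log (N * (c x / N)) ≤ _
    simp only [hterm]
    rw [← sum_div, div_le_iff₀ (by positivity)]
    refine hent.trans ?_
    have : Fintype.card X * 1 ≤ Fintype.card X * (2 * (N * ρ)) := by
      gcongr
      linarith
    linarith
end

section
/- Let S be a nonempty finite set and let p and q be probability distributions on S. Set α := (1/2)·Σ_{x∈S} |p(x) − q(x)|. Then the Shannon entropies H(p) := Σ_{x∈S} −p(x)·ln p(x) and H(q) := Σ_{x∈S} −q(x)·ln q(x) satisfy |H(p) − H(q)| ≤ 2·(α·ln|S| + h(α)), where h(α) := −α·ln α − (1−α)·ln(1−α) is the binary entropy of α (with the conventions 0·ln 0 = 0, so h(0) = h(1) = 0). -/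
open Real Finset

lemma mul_log_sub_mul_log_le {m b : ℝ} (hm : 0 ≤ m) (hb : 0 ≤ b) (h : b = 0 → m = 0) :
    m * log b - m * log m ≤ b - m := by
  rcases hm.eq_or_lt with rfl | hm
  · simpa using hb
  have hb' : 0 < b := hb.lt_of_ne fun e => hm.ne' (h e.symm)
  have h1 := log_le_sub_one_of_pos (div_pos hb' hm)
  rw [log_div hb'.ne' hm.ne'] at h1
  have h2 := mul_le_mul_of_nonneg_left h1 hm.le
  have h3 : m * (b / m - 1) = b - m := by field_simp
  linarith

/-- Gibbs' inequality for a nonnegative function `u` against a distribution `w`. -/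
lemma gibbs_inequality {S : Type*} [Fintype S] (u w : S → ℝ) (hu : ∀ x, 0 ≤ u x)
    (hw : ∀ x, 0 ≤ w x) (hw1 : ∑ x, w x = 1) (h : ∀ x, w x = 0 → u x = 0) {a : ℝ}
    (ha : ∑ x, u x = a) :
    ∑ x, u x * log (w x) + a * log a ≤ ∑ x, u x * log (u x) := by
  rcases (ha ▸ sum_nonneg fun x _ => hu x : 0 ≤ a).eq_or_lt with rfl | hpos
  · have h0 : ∀ x, u x = 0 := fun x =>
      (sum_eq_zero_iff_of_nonneg fun x _ => hu x).1 ha x (mem_univ x)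
    simp [h0]
  have key : ∀ x, u x * log (w x) + u x * log a - u x * log (u x) ≤ w x * a - u x := by
    intro x
    have h1 := mul_log_sub_mul_log_le (hu x) (mul_nonneg (hw x) hpos.le)
      fun e => h x ((mul_eq_zero.1 e).resolve_right hpos.ne')
    by_cases hx : w x = 0
    · simp [hx, h x hx]
    · rw [log_mul hx hpos.ne'] at h1
      linarith
  have hs := sum_le_sum fun x (_ : x ∈ univ) => key x
  simp only [sum_sub_distrib, sum_add_distrib, ← sum_mul, ha, hw1] at hs
  linarith

lemma mul_log_add_mul_log_le {a b : ℝ} (ha : 0 ≤ a) (hb : 0 ≤ b) :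
    a * log a + b * log b ≤ (a + b) * log (a + b) := by
  rcases ha.eq_or_lt with rfl | ha
  · simp
  rcases hb.eq_or_lt with rfl | hb
  · simp
  have h1 := mul_le_mul_of_nonneg_left (log_le_log ha (le_add_of_nonneg_right hb.le)) ha.le
  have h2 := mul_le_mul_of_nonneg_left (log_le_log hb (le_add_of_nonneg_left ha.le)) hb.le
  linarith

/-- One-sided continuity of entropy, through the common part `min (p x) (q x)`. -/
lemma entropy_sub_entropy_le {S : Type*} [Fintype S] [Nonempty S] (p q : S → ℝ)
    (hp0 : ∀ x, 0 ≤ p x) (hp1 : ∑ x, p x = 1) (hq0 : ∀ x, 0 ≤ q x) (hq1 : ∑ x, q x = 1)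
    (α : ℝ) (hα : α = (1 / 2) * ∑ x, |p x - q x|) :
    (∑ x, -(p x * log (p x))) - (∑ x, -(q x * log (q x)))
      ≤ α * log (Fintype.card S) + (-(α * log α) - (1 - α) * log (1 - α)) := by
  have hm0 : ∀ x, 0 ≤ min (p x) (q x) := fun x => le_min (hp0 x) (hq0 x)
  have hu0 : ∀ x, 0 ≤ p x - min (p x) (q x) := fun x => sub_nonneg.2 (min_le_left _ _)
  have hm : ∑ x, min (p x) (q x) = 1 - α := by
    have e : ∀ x, min (p x) (q x) = (1 / 2) * (p x + q x - |p x - q x|) := fun x => by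
      rcases le_total (p x) (q x) with h | h
      · rw [min_eq_left h, abs_of_nonpos (sub_nonpos.2 h)]; ring
      · rw [min_eq_right h, abs_of_nonneg (sub_nonneg.2 h)]; ring
    rw [sum_congr rfl fun x _ => e x, ← mul_sum, sum_sub_distrib, sum_add_distrib, hp1, hq1, hα]
    ring
  have hu : ∑ x, (p x - min (p x) (q x)) = α := by
    rw [sum_sub_distrib, hm, hp1]; ring
  have hn : (Fintype.card S : ℝ) ≠ 0 := Nat.cast_ne_zero.2 Fintype.card_ne_zero
  have g1 := gibbs_inequality _ (fun _ => (Fintype.card S : ℝ)⁻¹) hu0 (fun _ => by positivity)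
    (by simp [hn]) (fun _ e => absurd e (inv_ne_zero hn)) hu
  rw [← sum_mul, hu, log_inv] at g1
  have g2 := gibbs_inequality _ q hm0 hq0 hq1
    (fun x e => le_antisymm ((min_le_right _ _).trans e.le) (hm0 x)) hm
  have g3 : ∑ x, q x * log (q x) ≤ ∑ x, min (p x) (q x) * log (q x) := by
    refine sum_le_sum fun x _ => mul_le_mul_of_nonpos_right (min_le_right _ _) ?_
    exact log_nonpos (hq0 x) (hq1 ▸ single_le_sum (fun y _ => hq0 y) (mem_univ x))
  have g4 := sum_le_sum fun x (_ : x ∈ univ) => mul_log_add_mul_log_le (hm0 x) (hu0 x)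
  simp only [add_sub_cancel, sum_add_distrib] at g4
  simp only [sum_neg_distrib]
  linarith

/-- Continuity of Shannon entropy in total variation distance: for probability
distributions `p, q` on a nonempty finite set `S`, with
`α := (1/2)·Σ |p x − q x|`, one has
`|H(p) − H(q)| ≤ 2·(α·ln |S| + h(α))`, where `H(p) = Σ −p x · ln (p x)` and
`h(α) = −α·ln α − (1−α)·ln(1−α)` is the binary entropy.  (Since
`Real.log 0 = 0`, the conventions `0·ln 0 = 0` and `h(0) = h(1) = 0` hold.) -/
theorem entropy_totalvar_bound {S : Type*} [Fintype S] [Nonempty S]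
    (p q : S → ℝ)
    (hp0 : ∀ x, 0 ≤ p x) (hp1 : ∑ x, p x = 1)
    (hq0 : ∀ x, 0 ≤ q x) (hq1 : ∑ x, q x = 1)
    (α : ℝ) (hα : α = (1 / 2) * ∑ x, |p x - q x|) :
    |(∑ x, -(p x * Real.log (p x))) - (∑ x, -(q x * Real.log (q x)))|
      ≤ 2 * (α * Real.log (Fintype.card S)
          + (-(α * Real.log α) - (1 - α) * Real.log (1 - α))) := by
  have h1 := entropy_sub_entropy_le p q hp0 hp1 hq0 hq1 α hα
  have h2 := entropy_sub_entropy_le q p hq0 hq1 hp0 hp1 α (by simpa only [abs_sub_comm] using hα)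
  have h := abs_sub_le_iff.2 ⟨h1, h2⟩
  linarith [(abs_nonneg _).trans h]
end
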